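/- Let 𝒜 be a semiprime uniformly complete f-algebra and let p ∈ ℕ with p ≥ 2. If g₁, …, g_p ∈ 𝒜₊ are positive finite elements of 𝒜, then the (unique) positive p-th root (g₁⋯g_p)^(1/p) of their product is a finite element of 𝒜. -/

import Mathlib

namespace FiniteElementsPaper

/-- Product of `p` factors `φ 0 * φ 1 * ⋯ * φ (p-1)` in a (possibly non-unital)
multiplicative structure; junk value `0` when `p = 0`. -/
def mulProd {A : Type*} [Mul A] [Zero A] : (p : ℕ) → (Fin p → A) → A
  | 0, _ => 0
  | q + 1, φ => Fin.foldl q (fun acc i => acc * φ i.succ) (φ 0)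

/-- `p`-th power `a^p` (junk value `0` for `p = 0`). -/
def mpow {A : Type*} [Mul A] [Zero A] (a : A) (p : ℕ) : A :=
  mulProd p (fun _ => a)

/-- The set `Π_p(𝒜)` of all `p`-fold products. -/
def piSet (A : Type*) [Mul A] [Zero A] (p : ℕ) : Set A :=
  {x | ∃ φ : Fin p → A, x = mulProd p φ}

variable {A : Type*} [Lattice A] [AddCommGroup A] [Module ℝ A]

/-- `z` is a majorant of `φ`: `z ≥ 0` and for every `x` there is `c > 0` with
`|x| ⊓ n • |φ| ≤ c • z` for all `n`. -/
def IsMajorant (z φ : A) : Prop :=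
  0 ≤ z ∧ ∀ x : A, ∃ c : ℝ, 0 < c ∧ ∀ n : ℕ, |x| ⊓ n • |φ| ≤ c • z

/-- `φ` is a finite element. -/
def IsFiniteElt (φ : A) : Prop := ∃ z : A, IsMajorant z φ

/-- `φ` is a totally finite element: it has a majorant which is itself finite. -/
def IsTotallyFiniteElt (φ : A) : Prop := ∃ z : A, IsMajorant z φ ∧ IsFiniteElt z

/-- `φ` is self-majorizing: `|φ|` is a majorant of `φ`. -/
def IsSelfMajorizing (φ : A) : Prop := IsMajorant |φ| φ

/-- `φ ∈ Φ₃(A) = S₊(A) - S₊(A)`. -/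
def InPhi3 (φ : A) : Prop :=
  ∃ s t : A, 0 ≤ s ∧ 0 ≤ t ∧ IsSelfMajorizing s ∧ IsSelfMajorizing t ∧ φ = s - t

/-- `w` is a majorant of `φ` relative to the subset `S` (all lattice operations
computed in the ambient algebra). -/
def IsMajorantIn (S : Set A) (w φ : A) : Prop :=
  0 ≤ w ∧ ∀ x ∈ S, ∃ c : ℝ, 0 < c ∧ ∀ n : ℕ, |x| ⊓ n • |φ| ≤ c • w

/-- `φ` is a finite element of the sublattice `S` (majorant required to lie in `S`). -/
def IsFiniteEltIn (S : Set A) (φ : A) : Prop := ∃ w ∈ S, IsMajorantIn S w φ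

/-- `φ` is a totally finite element of the sublattice `S`. -/
def IsTotallyFiniteEltIn (S : Set A) (φ : A) : Prop :=
  ∃ w ∈ S, IsMajorantIn S w φ ∧ IsFiniteEltIn S w

/-- `φ` is self-majorizing in the sublattice `S`. -/
def IsSelfMajorizingIn (S : Set A) (φ : A) : Prop := IsMajorantIn S |φ| φ

/-- `φ ∈ Φ₃(S) = S₊(S) - S₊(S)` for the sublattice `S`. -/
def InPhi3In (S : Set A) (φ : A) : Prop :=
  ∃ s t : A, s ∈ S ∧ t ∈ S ∧ 0 ≤ s ∧ 0 ≤ t ∧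
    IsSelfMajorizingIn S s ∧ IsSelfMajorizingIn S t ∧ φ = s - t

variable (A) in
/-- Archimedean ℓ-algebra structure: an Archimedean vector lattice together with an
associative bilinear multiplication whose product of positive elements is positive. -/
structure IsLAlgebra [Mul A] : Prop where
  add_le_add_left : ∀ a b : A, a ≤ b → ∀ c : A, c + a ≤ c + b
  smul_le_smul : ∀ (r : ℝ) (a b : A), 0 ≤ r → a ≤ b → r • a ≤ r • b
  archimedean : ∀ a b : A, 0 ≤ a → (∀ n : ℕ, n • a ≤ b) → a = 0
  mul_assoc : ∀ a b c : A, a * b * c = a * (b * c)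
  left_distrib : ∀ a b c : A, a * (b + c) = a * b + a * c
  right_distrib : ∀ a b c : A, (a + b) * c = a * c + b * c
  smul_mul : ∀ (r : ℝ) (a b : A), (r • a) * b = r • (a * b)
  mul_smul : ∀ (r : ℝ) (a b : A), a * (r • b) = r • (a * b)
  mul_nonneg : ∀ a b : A, 0 ≤ a → 0 ≤ b → 0 ≤ a * b

variable (A) in
/-- A `d`-algebra: ℓ-algebra in which `a ⊓ b = 0` implies `(a*c) ⊓ (b*c) = (c*a) ⊓ (c*b) = 0`
for all `c ≥ 0`. -/
structure IsDAlgebra [Mul A] extends IsLAlgebra A : Prop where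
  d_prop : ∀ a b c : A, a ⊓ b = 0 → 0 ≤ c → (a * c) ⊓ (b * c) = 0 ∧ (c * a) ⊓ (c * b) = 0

variable (A) in
/-- An `f`-algebra: ℓ-algebra in which `a ⊓ b = 0` implies `(a*c) ⊓ b = (c*a) ⊓ b = 0`
for all `c ≥ 0`. -/
structure IsFAlgebra [Mul A] extends IsLAlgebra A : Prop where
  f_prop : ∀ a b c : A, a ⊓ b = 0 → 0 ≤ c → (a * c) ⊓ b = 0 ∧ (c * a) ⊓ b = 0

/-- `e` is a multiplicative unit. -/
def IsMulUnit [Mul A] (e : A) : Prop := ∀ a : A, a * e = a ∧ e * a = a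

/-- `e` is an order unit. -/
def IsOrderUnit (e : A) : Prop := 0 ≤ e ∧ ∀ x : A, ∃ l : ℝ, 0 ≤ l ∧ |x| ≤ l • e

variable (A) in
/-- The algebra is semiprime: `0` is its only nilpotent element. -/
def IsSemiprime [Mul A] [Zero A] : Prop :=
  ∀ (a : A) (n : ℕ), 0 < n → mpow a n = 0 → a = 0

variable (A) in
/-- The vector lattice is uniformly complete. -/
def UniformlyComplete : Prop :=
  ∀ u : A, 0 ≤ u → ∀ f : ℕ → A,
    (∀ ε : ℝ, 0 < ε → ∃ K : ℕ, ∀ m n : ℕ, K ≤ m → K ≤ n → |f m - f n| ≤ ε • u) →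
    ∃ a : A, ∀ ε : ℝ, 0 < ε → ∃ K : ℕ, ∀ n : ℕ, K ≤ n → |f n - a| ≤ ε • u

variable (A) in
/-- The weak factorization property: every element is dominated by a product. -/
def WeakFactorization [Mul A] : Prop := ∀ a : A, ∃ b c : A, a ≤ b * c

section Products

variable {A : Type*}

theorem mulProd_one [Mul A] [Zero A] (φ : Fin 1 → A) : mulProd 1 φ = φ 0 := by
  simp [mulProd]

theorem mulProd_add_two [Mul A] [Zero A] (q : ℕ) (φ : Fin (q + 2) → A) :
    mulProd (q + 2) φ = mulProd (q + 1) (fun i => φ i.castSucc) * φ (Fin.last (q + 1)) := by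
  simp [mulProd, Fin.foldl_succ_last]

theorem mpow_one [Mul A] [Zero A] (a : A) : mpow a 1 = a :=
  mulProd_one _

theorem mpow_add_two [Mul A] [Zero A] (a : A) (q : ℕ) :
    mpow a (q + 2) = mpow a (q + 1) * a :=
  mulProd_add_two q _

theorem mul_mpow_succ [NonUnitalRing A] (a : A) (q : ℕ) :
    a * mpow a (q + 1) = mpow a (q + 2) := by
  induction q with
  | zero => rw [mpow_add_two, zero_add, mpow_one]
  | succ q ih => rw [mpow_add_two a q, ← mul_assoc, ih, mpow_add_two a (q + 1)]

end Products

section LatticeOrdered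

variable {A : Type*} [Lattice A] [AddCommGroup A] [IsOrderedAddMonoid A]

theorem inf_add_le_inf_add_inf {x u v : A} (hx : 0 ≤ x) (hu : 0 ≤ u) (hv : 0 ≤ v) :
    x ⊓ (u + v) ≤ x ⊓ u + x ⊓ v := by
  rw [inf_add, add_inf, add_inf]
  refine le_inf (le_inf ?_ ?_) (le_inf ?_ ?_)
  · exact inf_le_left.trans (le_add_of_nonneg_left hx)
  · exact inf_le_left.trans (le_add_of_nonneg_right hv)
  · exact inf_le_left.trans (le_add_of_nonneg_left hu)
  · exact inf_le_right

variable [Module ℝ A]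

theorem IsFiniteElt.of_le {a b : A} (ha : 0 ≤ a) (hab : a ≤ b) (hb : IsFiniteElt b) :
    IsFiniteElt a := by
  obtain ⟨z, hz, h⟩ := hb
  refine ⟨z, hz, fun x => ?_⟩
  obtain ⟨c, hc, hcz⟩ := h x
  refine ⟨c, hc, fun n => (inf_le_inf_left _ ?_).trans (hcz n)⟩
  rw [abs_of_nonneg ha, abs_of_nonneg (ha.trans hab)]
  exact nsmul_le_nsmul_right hab n

theorem IsFiniteElt.add
    (hsmul : ∀ (r : ℝ) (a b : A), 0 ≤ r → a ≤ b → r • a ≤ r • b)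
    {a b : A} (ha : 0 ≤ a) (hb : 0 ≤ b) (hfa : IsFiniteElt a) (hfb : IsFiniteElt b) :
    IsFiniteElt (a + b) := by
  obtain ⟨z, hz, h⟩ := hfa
  obtain ⟨w, hw, k⟩ := hfb
  refine ⟨z + w, add_nonneg hz hw, fun x => ?_⟩
  obtain ⟨c, hc, hcz⟩ := h x
  obtain ⟨d, hd, hdw⟩ := k x
  refine ⟨c + d, add_pos hc hd, fun n => ?_⟩
  have hcz' := hcz n
  have hdw' := hdw n
  rw [abs_of_nonneg ha] at hcz'
  rw [abs_of_nonneg hb] at hdw'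
  rw [abs_of_nonneg (add_nonneg ha hb), nsmul_add]
  refine (inf_add_le_inf_add_inf (abs_nonneg x) (nsmul_nonneg ha n) (nsmul_nonneg hb n)).trans ?_
  have hdz : 0 ≤ d • z := by simpa using hsmul d 0 z hd.le hz
  have hcw : 0 ≤ c • w := by simpa using hsmul c 0 w hc.le hw
  calc |x| ⊓ n • a + |x| ⊓ n • b ≤ c • z + d • w := add_le_add hcz' hdw'
    _ ≤ (c • z + d • z) + (c • w + d • w) :=
        add_le_add (le_add_of_nonneg_right hdz) (le_add_of_nonneg_left hcw)
    _ = (c + d) • (z + w) := by rw [smul_add, add_smul, add_smul]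

theorem IsFiniteElt.zero : IsFiniteElt (0 : A) :=
  ⟨0, le_rfl, fun x => ⟨1, one_pos, fun n => by simp⟩⟩

theorem IsFiniteElt.sum
    (hsmul : ∀ (r : ℝ) (a b : A), 0 ≤ r → a ≤ b → r • a ≤ r • b)
    {ι : Type*} (s : Finset ι) {g : ι → A} (hg : ∀ i, 0 ≤ g i ∧ IsFiniteElt (g i)) :
    IsFiniteElt (∑ i ∈ s, g i) := by
  classical
  induction s using Finset.induction_on with
  | empty => simpa using IsFiniteElt.zero
  | insert i s hi ih =>
    rw [Finset.sum_insert hi]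
    exact IsFiniteElt.add hsmul (hg i).1 (Finset.sum_nonneg fun j _ => (hg j).1) (hg i).2 ih

end LatticeOrdered

section Roots

variable {A : Type*} [Lattice A] [NonUnitalRing A]

theorem mulProd_nonneg (hmul : ∀ a b : A, 0 ≤ a → 0 ≤ b → 0 ≤ a * b) (q : ℕ)
    (φ : Fin (q + 1) → A) (hφ : ∀ i, 0 ≤ φ i) : 0 ≤ mulProd (q + 1) φ := by
  induction q with
  | zero => simpa [mulProd_one] using hφ 0
  | succ q ih =>
    rw [mulProd_add_two]
    exact hmul _ _ (ih _ fun i => hφ _) (hφ _)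

theorem mul_eq_zero_of_inf_eq_zero
    (hf : ∀ a b c : A, a ⊓ b = 0 → 0 ≤ c → (a * c) ⊓ b = 0 ∧ (c * a) ⊓ b = 0)
    {a b : A} (h : a ⊓ b = 0) : a * b = 0 := by
  have ha : 0 ≤ a := h ▸ inf_le_left
  have hb : 0 ≤ b := h ▸ inf_le_right
  have h₁ := (hf a b b h hb).1
  rw [inf_comm] at h₁
  simpa using (hf b (a * b) a h₁ ha).2

variable [IsOrderedAddMonoid A]

theorem mulProd_le_mpow (hmul : ∀ a b : A, 0 ≤ a → 0 ≤ b → 0 ≤ a * b) (q : ℕ)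
    (φ : Fin (q + 1) → A) (s : A) (hφ : ∀ i, 0 ≤ φ i) (hs : ∀ i, φ i ≤ s) :
    mulProd (q + 1) φ ≤ mpow s (q + 1) := by
  induction q with
  | zero => simpa [mulProd_one, mpow_one] using hs 0
  | succ q ih =>
    rw [mulProd_add_two, mpow_add_two, ← sub_nonneg]
    have hP := mulProd_nonneg hmul q (fun i => φ i.castSucc) fun i => hφ _
    have hle := ih (fun i => φ i.castSucc) (fun i => hφ _) fun i => hs _
    have h₁ := hmul _ _ (sub_nonneg.2 hle) ((hφ 0).trans (hs 0))
    have h₂ := hmul _ _ hP (sub_nonneg.2 (hs (Fin.last (q + 1))))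
    rw [sub_mul] at h₁
    rw [mul_sub] at h₂
    simpa using add_nonneg h₁ h₂

theorem mul_mpow_add_le (hmul : ∀ a b : A, 0 ≤ a → 0 ≤ b → 0 ≤ a * b)
    (hf : ∀ a b c : A, a ⊓ b = 0 → 0 ≤ c → (a * c) ⊓ b = 0 ∧ (c * a) ⊓ b = 0)
    {b s : A} (hb : 0 ≤ b) (hs : 0 ≤ s) (q : ℕ) :
    (b - s)⁺ * mpow s (q + 1) + (b - s)⁺ * mpow (b - s)⁺ (q + 1)
      ≤ (b - s)⁺ * mpow b (q + 1) := by
  have hd : 0 ≤ (b - s)⁺ := posPart_nonneg _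
  have hdisj : (b - s)⁺ ⊓ (b - s)⁻ = 0 := posPart_inf_negPart_eq_zero _
  have hsub : (b - s)⁺ - (b - s)⁻ = b - s := posPart_sub_negPart _
  set d := (b - s)⁺
  set e := (b - s)⁻
  have hmulb : ∀ y : A, y ⊓ e = 0 → y * b = y * s + y * d := by
    intro y hy
    have := congrArg (y * ·) hsub
    simp only [mul_sub, mul_eq_zero_of_inf_eq_zero hf hy, sub_zero] at this
    rw [this]
    abel
  induction q with
  | zero => rw [zero_add, mpow_one, mpow_one, mpow_one, hmulb d hdisj]
  | succ q ih =>
    have hpow : ∀ a : A, 0 ≤ a → 0 ≤ mpow a (q + 1) := fun a ha =>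
      mulProd_nonneg hmul q _ fun _ => ha
    have h₁ := hmul _ _ (sub_nonneg.2 ih) hb
    have h₂ := hmulb _ (hf d e _ hdisj (hpow s hs)).1
    have h₃ := hmulb _ (hf d e _ hdisj (hpow d hd)).1
    have h₄ := hmul _ _ (hmul _ _ hd (hpow s hs)) hd
    have h₅ := hmul _ _ (hmul _ _ hd (hpow d hd)) hs
    rw [sub_mul, add_mul, h₂, h₃] at h₁
    simp only [mpow_add_two, ← mul_assoc]
    rw [← sub_nonneg]
    convert add_nonneg h₁ (add_nonneg h₄ h₅) using 1
    abel

theorem le_of_mpow_le_mpow (hmul : ∀ a b : A, 0 ≤ a → 0 ≤ b → 0 ≤ a * b)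
    (hf : ∀ a b c : A, a ⊓ b = 0 → 0 ≤ c → (a * c) ⊓ b = 0 ∧ (c * a) ⊓ b = 0)
    (hsp : IsSemiprime A) {b s : A} (hb : 0 ≤ b) (hs : 0 ≤ s) (q : ℕ)
    (h : mpow b (q + 1) ≤ mpow s (q + 1)) : b ≤ s := by
  have hd : 0 ≤ (b - s)⁺ := posPart_nonneg _
  have h₁ := mul_mpow_add_le hmul hf hb hs q
  have h₂ := hmul _ _ hd (sub_nonneg.2 h)
  rw [mul_sub, sub_nonneg] at h₂
  have h₃ : mpow (b - s)⁺ (q + 2) ≤ 0 := by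
    rw [← mul_mpow_succ]
    exact (add_le_iff_nonpos_right _).1 (h₁.trans h₂)
  have h₄ : mpow (b - s)⁺ (q + 2) = 0 :=
    le_antisymm h₃ (mulProd_nonneg hmul (q + 1) _ fun _ => hd)
  exact sub_nonpos.1 (posPart_eq_zero.1 (hsp _ _ (by omega) h₄))

end Roots

/-- The non-unital ring underlying an ℓ-algebra. -/
abbrev IsLAlgebra.nonUnitalRing {A : Type*} [Lattice A] [i : AddCommGroup A] [Module ℝ A]
    [m : Mul A] (h : IsLAlgebra A) : NonUnitalRing A :=
  { i, m with
    left_distrib := h.left_distrib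
    right_distrib := h.right_distrib
    zero_mul := fun a => by simpa using h.smul_mul 0 0 a
    mul_zero := fun a => by simpa using h.mul_smul 0 a 0
    mul_assoc := h.mul_assoc }

/-- In a semiprime uniformly complete f-algebra, the positive p-th root of a
product of positive finite elements is a finite element. -/
theorem stmt16 {A : Type*} [Lattice A] [AddCommGroup A] [Module ℝ A] [Mul A]
    (hA : IsFAlgebra A) (hsp : IsSemiprime A) (huc : UniformlyComplete A)
    (p : ℕ) (hp : 2 ≤ p) (g : Fin p → A) (hg : ∀ i, 0 ≤ g i ∧ IsFiniteElt (g i))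
    (b : A) (hb : 0 ≤ b) (hroot : mpow b p = mulProd p g) :
    IsFiniteElt b := by
  have : IsOrderedAddMonoid A :=
    { add_le_add_left := fun a b hab c => by
        simpa only [add_comm] using hA.add_le_add_left a b hab c }
  have hsum : ∀ i, g i ≤ ∑ j, g j := fun i =>
    Finset.single_le_sum (fun j _ => (hg j).1) (Finset.mem_univ i)
  have hs : 0 ≤ ∑ j, g j := Finset.sum_nonneg fun j _ => (hg j).1
  refine IsFiniteElt.of_le hb ?_ (IsFiniteElt.sum hA.smul_le_smul Finset.univ hg)
  obtain ⟨q, rfl⟩ : ∃ q, p = q + 1 := ⟨p - 1, by omega⟩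
  let _ : NonUnitalRing A := hA.toIsLAlgebra.nonUnitalRing
  refine le_of_mpow_le_mpow hA.mul_nonneg hA.f_prop hsp hb hs q ?_
  exact hroot.le.trans (mulProd_le_mpow hA.mul_nonneg q g _ (fun i => (hg i).1) hsum)

end FiniteElementsPaper
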